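/- Let ψ : ℕ → ℝ⁺ be non-decreasing with ∑_{n=1}^∞ n^{r−1} ψ(n)^{−r} < ∞ for an integer r ≥ 1. Then the set F(r, ψ) = {x ∈ [0,1) : ∃ 1 ≤ k₁ < ⋯ < k_r ≤ n with a_{k_i}(x) ≥ ψ(n) for all i, for infinitely many n} has Lebesgue measure zero. -/

import Mathlib

open MeasureTheory Filter Set

/-- The Gauss map. -/
noncomputable def gaussMap (x : ℝ) : ℝ := if x = 0 then 0 else 1 / x - ⌊(1 / x : ℝ)⌋

/-- The `k`-th partial quotient of the continued fraction expansion of `x` (for `k ≥ 1`). -/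
noncomputable def cfa (k : ℕ) (x : ℝ) : ℕ := ⌊1 / (gaussMap^[k - 1] x)⌋₊

/-- The set `F(r, ψ)` of points with at least `r` partial quotients `≥ ψ(n)` among the
first `n` terms, for infinitely many `n`. -/
noncomputable def Fset (r : ℕ) (ψ : ℕ → ℝ) : Set ℝ :=
  {x | x ∈ Set.Ico (0 : ℝ) 1 ∧ ∀ N : ℕ, ∃ n ≥ N, ∃ k : Fin r → ℕ,
    StrictMono k ∧ (∀ i, 1 ≤ k i ∧ k i ≤ n) ∧ ∀ i, ψ n ≤ (cfa (k i) x : ℝ)}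

noncomputable def gmH (x : ℝ) : ENNReal := ENNReal.ofReal (1 / (1 + x))

noncomputable def gmNu : Measure ℝ := (volume.restrict (Ico (0:ℝ) 1)).withDensity gmH

lemma gmH_meas : Measurable gmH := by
  unfold gmH; fun_prop

lemma gm_meas : Measurable gaussMap := by
  unfold gaussMap
  refine Measurable.ite (measurableSet_singleton 0) measurable_const ?_
  have h1 : Measurable fun x : ℝ => 1 / x := by fun_prop
  have h2 : Measurable fun x : ℝ => ((⌊1 / x⌋ : ℤ) : ℝ) :=
    (measurable_from_top (f := fun z : ℤ => (z : ℝ))).comp (Int.measurable_floor.comp h1)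
  exact h1.sub h2

lemma gmNu_apply {B : Set ℝ} (hB : MeasurableSet B) :
    gmNu B = ∫⁻ y in B ∩ Ico (0:ℝ) 1, gmH y := by
  unfold gmNu
  rw [withDensity_apply _ hB, Measure.restrict_restrict hB]

/-- telescoping -/
lemma gm_tel (m : ℕ) (hm : 1 ≤ m) (y : ℝ) (hy : 0 ≤ y) :
    ∑' j : ℕ, ENNReal.ofReal (1 / (((m + j : ℕ) + y) * ((m + j : ℕ) + y + 1)))
      ≤ ENNReal.ofReal (1 / (m + y)) := by
  apply ENNReal.tsum_le_of_sum_range_le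
  intro n
  have hm' : (1:ℝ) ≤ m := by exact_mod_cast hm
  rw [← ENNReal.ofReal_sum_of_nonneg (fun i _ => by positivity)]
  apply ENNReal.ofReal_le_ofReal
  have : ∑ i ∈ Finset.range n, 1 / ((((m + i : ℕ):ℝ) + y) * (((m + i : ℕ):ℝ) + y + 1))
      = 1 / (m + y) - 1 / (m + n + y) := by
    induction n with
    | zero => simp
    | succ k ih =>
      rw [Finset.sum_range_succ, ih]
      push_cast
      have h1 : (m:ℝ) + y ≠ 0 := by positivity
      have h2 : (m:ℝ) + k + y ≠ 0 := by positivity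
      have h3 : (m:ℝ) + k + y + 1 ≠ 0 := by positivity
      have h4 : (m:ℝ) + (k + 1) + y ≠ 0 := by positivity
      field_simp
      ring
  rw [this]
  have : 0 ≤ 1 / ((m:ℝ) + n + y) := by positivity
  linarith

lemma gm_branch (a : ℕ) (ha : 1 ≤ a) (B : Set ℝ) (hB : MeasurableSet B) (hB1 : B ⊆ Ico 0 1) :
    gmNu ((fun y : ℝ => 1 / (a + y)) '' B) ≤
      ∫⁻ y in B, ENNReal.ofReal (1 / ((a + y) * (a + y + 1))) := by
  have ha' : (1:ℝ) ≤ a := by exact_mod_cast ha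
  have hd : ∀ y ∈ B, HasDerivWithinAt (fun y : ℝ => 1 / (a + y)) (-1 / (a + y) ^ 2) B y := by
    intro y hy
    have h0 : (a:ℝ) + y ≠ 0 := by have := (hB1 hy).1; positivity
    have h1 : HasDerivAt (fun y : ℝ => (a:ℝ) + y) 1 y := (hasDerivAt_id y).const_add _
    have := h1.inv h0
    have h3 := this.hasDerivWithinAt (s := B)
    refine h3.congr_of_mem (fun z _ => ?_) hy
    simp [one_div]
  have hinj : InjOn (fun y : ℝ => 1 / ((a:ℝ) + y)) B := by
    intro y hy z hz h
    have h0 : (a:ℝ) + y ≠ 0 := by have := (hB1 hy).1; positivity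
    have h1 : (a:ℝ) + z ≠ 0 := by have := (hB1 hz).1; positivity
    simp only [one_div, inv_inj] at h
    linarith
  have hmeas : MeasurableSet ((fun y : ℝ => 1 / ((a:ℝ) + y)) '' B) :=
    measurable_image_of_fderivWithin hB (fun y hy => (hd y hy).hasFDerivWithinAt) hinj
  rw [gmNu_apply hmeas]
  refine (lintegral_mono_set inter_subset_left).trans ?_
  rw [lintegral_image_eq_lintegral_abs_deriv_mul hB hd hinj]
  apply setLIntegral_mono' hB
  intro y hy
  unfold gmH
  rw [← ENNReal.ofReal_mul (abs_nonneg _)]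
  apply ENNReal.ofReal_le_ofReal
  have h00 := (hB1 hy).1
  have h0 : 0 < (a:ℝ) + y := by positivity
  rw [neg_div, abs_neg, abs_of_nonneg (by positivity)]
  apply le_of_eq
  field_simp

lemma gm_key (m : ℕ) (hm : 1 ≤ m) (B : Set ℝ) (hB : MeasurableSet B) :
    gmNu ({x | m ≤ ⌊1 / x⌋₊} ∩ gaussMap ⁻¹' B) ≤
      ∫⁻ y in B ∩ Ico (0:ℝ) 1, ENNReal.ofReal (1 / (m + y)) := by
  set C := B ∩ Ico (0:ℝ) 1 with hC
  have hCm : MeasurableSet C := hB.inter measurableSet_Ico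
  have hsub : ({x : ℝ | m ≤ ⌊1 / x⌋₊} ∩ gaussMap ⁻¹' B) ⊆
      (Ico (0:ℝ) 1)ᶜ ∪ ⋃ j : ℕ, (fun y : ℝ => 1 / (((m + j : ℕ):ℝ) + y)) '' C := by
    rintro x ⟨hx1, hx2⟩
    by_cases hx : x ∈ Ico (0:ℝ) 1
    · right
      simp only [mem_ofPred_eq] at hx1
      have hx0 : x ≠ 0 := by
        rintro rfl
        simp at hx1; omega
      have hxp : 0 < x := lt_of_le_of_ne hx.1 (Ne.symm hx0)
      obtain ⟨j, hj⟩ := Nat.exists_eq_add_of_le hx1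
      have hT : gaussMap x = 1 / x - (⌊1 / x⌋₊ : ℕ) := by
        unfold gaussMap
        rw [if_neg hx0, natCast_floor_eq_intCast_floor (by positivity)]
      refine mem_iUnion.2 ⟨j, gaussMap x, ⟨hx2, ?_, ?_⟩, ?_⟩
      · rw [hT]; have := Nat.floor_le (show 0 ≤ 1 / x by positivity); linarith
      · rw [hT]; have := Nat.lt_floor_add_one (1 / x); linarith
      · simp only
        rw [hT, ← hj]; field_simp; ring
    · left; exact hx
  have h0 : gmNu (Ico (0:ℝ) 1)ᶜ = 0 := by
    rw [gmNu_apply measurableSet_Ico.compl]; simp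
  calc _ ≤ _ := measure_mono hsub
    _ ≤ gmNu (Ico (0:ℝ) 1)ᶜ + _ := measure_union_le _ _
    _ ≤ 0 + ∑' j : ℕ, ∫⁻ y in C, ENNReal.ofReal (1 / ((((m + j : ℕ):ℝ) + y) * (((m + j : ℕ):ℝ) + y + 1))) := by
        rw [h0]
        gcongr
        refine (measure_iUnion_le _).trans (ENNReal.tsum_le_tsum fun j => ?_)
        exact gm_branch (m + j) (by omega) C hCm inter_subset_right
    _ = ∫⁻ y in C, ∑' j : ℕ, ENNReal.ofReal (1 / ((((m + j : ℕ):ℝ) + y) * (((m + j : ℕ):ℝ) + y + 1))) := by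
        rw [zero_add, lintegral_tsum]
        intro j
        apply Measurable.aemeasurable
        fun_prop
    _ ≤ _ := by
        apply setLIntegral_mono' hCm
        intro y hy
        exact gm_tel m hm y hy.2.1

lemma gm_inv (B : Set ℝ) (hB : MeasurableSet B) : gmNu (gaussMap ⁻¹' B) ≤ gmNu B := by
  have h1 := gm_key 1 le_rfl B hB
  have h2 : gmNu (gaussMap ⁻¹' B) ≤ gmNu ((Ioo (0:ℝ) 1)ᶜ ∪ ({x | 1 ≤ ⌊1 / x⌋₊} ∩ gaussMap ⁻¹' B)) := by
    apply measure_mono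
    intro x hx
    by_cases h : x ∈ Ioo (0:ℝ) 1
    · right
      refine ⟨?_, hx⟩
      simp only [mem_ofPred_eq]
      rw [Nat.one_le_floor_iff, le_div_iff₀ h.1]
      linarith [h.2]
    · left; exact h
  have h0 : gmNu (Ioo (0:ℝ) 1)ᶜ = 0 := by
    rw [gmNu_apply measurableSet_Ioo.compl]
    apply setLIntegral_measure_zero
    refine measure_mono_null (t := {0}) ?_ (by simp)
    rintro x ⟨hx, hx1⟩
    by_contra h
    exact hx ⟨lt_of_le_of_ne hx1.1 (Ne.symm h), hx1.2⟩
  refine h2.trans ((measure_union_le _ _).trans ?_)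
  rw [h0, zero_add, gmNu_apply hB]
  simpa [gmH] using h1

lemma gm_A (t : ℝ) (ht : 0 < t) (B : Set ℝ) (hB : MeasurableSet B) :
    gmNu ({x | t ≤ (cfa 1 x : ℝ)} ∩ gaussMap ⁻¹' B) ≤ ENNReal.ofReal (2 / t) * gmNu B := by
  have hm : 1 ≤ ⌈t⌉₊ := Nat.one_le_iff_ne_zero.2 (by simpa using ht)
  have h1 := gm_key ⌈t⌉₊ hm B hB
  have e : {x : ℝ | t ≤ (cfa 1 x : ℝ)} = {x | ⌈t⌉₊ ≤ ⌊1 / x⌋₊} := by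
    ext x; simp [cfa, Nat.ceil_le]
  rw [e]
  refine h1.trans ?_
  rw [gmNu_apply hB, ← lintegral_const_mul _ gmH_meas]
  apply setLIntegral_mono' (hB.inter measurableSet_Ico)
  rintro y ⟨-, hy0, hy1⟩
  unfold gmH
  rw [← ENNReal.ofReal_mul (by positivity)]
  apply ENNReal.ofReal_le_ofReal
  have hc := Nat.le_ceil t
  rw [div_mul_div_comm, div_le_div_iff₀ (by positivity) (by positivity)]
  nlinarith

/-- points with at least `r` large partial quotients among the first `n` -/
def gmG (t : ℝ) : ℕ → ℕ → Set ℝ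
  | _, 0 => univ
  | 0, _ + 1 => ∅
  | n + 1, r + 1 => gaussMap ⁻¹' gmG t n (r + 1) ∪
      ({x | t ≤ (cfa 1 x : ℝ)} ∩ gaussMap ⁻¹' gmG t n r)

lemma cfa1_meas (t : ℝ) : MeasurableSet {x : ℝ | t ≤ (cfa 1 x : ℝ)} := by
  have h1 : Measurable fun x : ℝ => 1 / x := by fun_prop
  have : Measurable fun x : ℝ => (cfa 1 x : ℝ) := by
    simp only [cfa, Nat.sub_self, Function.iterate_zero, id]
    exact (measurable_from_top (f := fun z : ℕ => (z : ℝ))).comp (Nat.measurable_floor.comp h1)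
  exact measurableSet_le measurable_const this

lemma gmG_meas (t : ℝ) : ∀ n r, MeasurableSet (gmG t n r)
  | 0, 0 => by simp [gmG]
  | n + 1, 0 => by simp [gmG]
  | 0, r + 1 => by simp [gmG]
  | n + 1, r + 1 => by
    rw [gmG]
    exact (gm_meas (gmG_meas t n (r+1))).union ((cfa1_meas t).inter (gm_meas (gmG_meas t n r)))

lemma gmNu_univ : gmNu univ ≤ 1 := by
  rw [gmNu_apply MeasurableSet.univ, univ_inter]
  calc _ ≤ ∫⁻ y in Ico (0:ℝ) 1, 1 := by
        apply setLIntegral_mono' measurableSet_Ico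
        intro y hy
        unfold gmH
        rw [ENNReal.ofReal_le_one, div_le_one (by linarith [hy.1])]
        linarith [hy.1]
    _ = 1 := by simp

lemma gmG_le (t : ℝ) (ht : 0 < t) : ∀ n r, gmNu (gmG t n r) ≤ (n * ENNReal.ofReal (2 / t)) ^ r
  | 0, 0 => by simpa [gmG] using gmNu_univ
  | n + 1, 0 => by simpa [gmG] using gmNu_univ
  | 0, r + 1 => by simp [gmG]
  | n + 1, r + 1 => by
    rw [gmG]
    refine (measure_union_le _ _).trans ?_
    have h1 := (gm_inv _ (gmG_meas t n (r+1))).trans (gmG_le t ht n (r+1))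
    have h2 := (gm_A t ht _ (gmG_meas t n r)).trans (mul_le_mul_right (gmG_le t ht n r) _)
    refine (add_le_add h1 h2).trans ?_
    set c := ENNReal.ofReal (2 / t)
    calc (n * c) ^ (r + 1) + c * (n * c) ^ r = (n * c) ^ r * ((n + 1 : ℕ) * c) := by
          push_cast; ring
      _ ≤ ((n + 1 : ℕ) * c) ^ r * ((n + 1 : ℕ) * c) := by
          gcongr; omega
      _ = _ := by rw [pow_succ]

lemma cfa_succ (k : ℕ) (hk : 2 ≤ k) (x : ℝ) : cfa k x = cfa (k - 1) (gaussMap x) := by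
  obtain ⟨j, rfl⟩ := Nat.exists_eq_add_of_le hk
  unfold cfa
  rw [← Function.iterate_succ_apply]
  congr 4
  omega

lemma mem_gmG (t : ℝ) : ∀ (n r : ℕ) (x : ℝ) (k : Fin r → ℕ), StrictMono k →
    (∀ i, 1 ≤ k i ∧ k i ≤ n) → (∀ i, t ≤ (cfa (k i) x : ℝ)) → x ∈ gmG t n r
  | 0, 0, _, _, _, _, _ => by simp [gmG]
  | n + 1, 0, _, _, _, _, _ => by simp [gmG]
  | 0, r + 1, x, k, _, hb, _ => by have := hb 0; omega
  | n + 1, r + 1, x, k, hk, hb, hc => by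
    rw [gmG]
    by_cases h0 : k 0 = 1
    · right
      have h2 : ∀ i : Fin r, 2 ≤ k i.succ := fun i => by
        have := hk (Fin.succ_pos i); omega
      refine ⟨by simpa [h0] using hc 0, ?_⟩
      refine mem_gmG t n r (gaussMap x) (fun i => k i.succ - 1) ?_ ?_ ?_
      · intro i j hij
        have := hk (Fin.succ_lt_succ_iff.2 hij)
        have := h2 i
        show k i.succ - 1 < k j.succ - 1
        omega
      · intro i; have := h2 i; have := hb i.succ; omega
      · intro i; rw [← cfa_succ _ (h2 i)]; exact hc _
    · left
      have h2 : ∀ i, 2 ≤ k i := fun i => by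
        have := hk.monotone (Fin.zero_le i); have := hb 0; omega
      refine mem_gmG t n (r + 1) (gaussMap x) (fun i => k i - 1) ?_ ?_ ?_
      · intro i j hij
        have := hk hij
        have := h2 i
        show k i - 1 < k j - 1
        omega
      · intro i; have := h2 i; have := hb i; omega
      · intro i; rw [← cfa_succ _ (h2 i)]; exact hc _

lemma gm_cond (r : ℕ) (hr : 1 ≤ r) (ψ : ℕ → ℝ) (hpos : ∀ n, 0 < ψ n)
    (hmono : Monotone ψ)
    (hsum : Summable fun n : ℕ => (n : ℝ) ^ (r - 1) / ψ n ^ r) :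
    Summable fun m : ℕ => ((2:ℝ) ^ m) ^ r / ψ (2 ^ (m + 1)) ^ r := by
  set f : ℕ → ℝ := fun n => (n : ℝ) ^ (r - 1) / ψ n ^ r with hf
  have hf0 : ∀ n, 0 ≤ f n := fun n => by have := hpos n; simp only [hf]; positivity
  refine summable_of_sum_range_le (c := ∑' n, f n)
    (fun m => by have := hpos (2 ^ (m+1)); positivity) (fun M => ?_)
  have : ∑ m ∈ Finset.range M, ((2:ℝ) ^ m) ^ r / ψ (2 ^ (m + 1)) ^ r ≤
      ∑ n ∈ Finset.range (2 ^ M + 1), f n := by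
    induction M with
    | zero => simpa using Finset.sum_nonneg (fun i _ => hf0 i)
    | succ M ih =>
      rw [Finset.sum_range_succ]
      have h2 : 2 ^ M + 1 ≤ 2 ^ (M + 1) + 1 := by rw [pow_succ]; omega
      rw [← Finset.sum_range_add_sum_Ico f h2]
      refine add_le_add ih ?_
      have hb : ∀ n ∈ Finset.Ico (2 ^ M + 1) (2 ^ (M + 1) + 1),
          ((2:ℝ) ^ M) ^ (r - 1) / ψ (2 ^ (M + 1)) ^ r ≤ f n := by
        intro n hn
        rw [Finset.mem_Ico] at hn
        have a1 : (2:ℝ) ^ M ≤ n := by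
          have : 2 ^ M ≤ n := by omega
          exact_mod_cast this
        have a2 : ψ n ≤ ψ (2 ^ (M + 1)) := hmono (by omega)
        have a3 := hpos n
        simp only [hf]
        gcongr
      have := Finset.card_nsmul_le_sum _ f _ hb
      refine le_trans (le_of_eq ?_) this
      have hc : (Finset.Ico (2 ^ M + 1) (2 ^ (M + 1) + 1)).card = 2 ^ M := by
        rw [Nat.card_Ico, pow_succ]; omega
      rw [hc, nsmul_eq_mul]
      obtain ⟨s, rfl⟩ := Nat.exists_eq_add_of_le' hr
      push_cast
      rw [pow_succ ((2:ℝ) ^ M) s]; ring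
  exact this.trans (hsum.sum_le_tsum _ (fun i _ => hf0 i))

theorem stmt_10 (r : ℕ) (hr : 1 ≤ r) (ψ : ℕ → ℝ) (hpos : ∀ n, 0 < ψ n)
    (hmono : Monotone ψ)
    (hsum : Summable fun n : ℕ => (n : ℝ) ^ (r - 1) / ψ n ^ r) :
    MeasureTheory.volume (Fset r ψ) = 0 := by
  have hs := gm_cond r hr ψ hpos hmono hsum
  set E : ℕ → Set ℝ := fun m => gmG (ψ (2 ^ (m + 1))) (2 ^ (m + 2)) r with hE
  have hEle : ∀ m, gmNu (E m) ≤ ENNReal.ofReal (8 ^ r * (((2:ℝ) ^ m) ^ r / ψ (2 ^ (m + 1)) ^ r)) := by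
    intro m
    have hp := hpos (2 ^ (m + 1))
    refine (gmG_le _ hp _ _).trans (le_of_eq ?_)
    rw [← ENNReal.ofReal_natCast, ← ENNReal.ofReal_mul (by positivity),
      ← ENNReal.ofReal_pow (by positivity)]
    congr 1
    rw [← div_pow, ← mul_pow]
    congr 1
    push_cast
    ring
  have hfin : ∑' m, gmNu (E m) ≠ ⊤ := by
    refine ne_top_of_le_ne_top ?_ (ENNReal.tsum_le_tsum hEle)
    exact (hs.mul_left _).tsum_ofReal_ne_top
  have h0 := measure_setOfPred_frequently_eq_zero (p := fun m x => x ∈ E m) hfin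
  have hsub : Fset r ψ ⊆ {x | ∃ᶠ m in atTop, x ∈ E m} := by
    rintro x ⟨-, hx⟩
    simp only [mem_ofPred_eq]
    rw [frequently_atTop]
    intro M
    obtain ⟨n, hn, k, hk, hb, hc⟩ := hx (2 ^ (M + 1))
    have hn0 : n ≠ 0 := by
      have : 0 < 2 ^ (M + 1) := by positivity
      omega
    have hl : M + 1 ≤ Nat.log 2 n := (Nat.le_log_iff_pow_le (by norm_num) hn0).2 hn
    obtain ⟨j, hj⟩ := Nat.exists_eq_add_of_le hl
    have l1 : 2 ^ (M + j + 1) ≤ n := by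
      have := Nat.pow_log_le_self 2 hn0
      rwa [hj, show M + 1 + j = M + j + 1 by ring] at this
    have l2 : n < 2 ^ (M + j + 2) := by
      have := Nat.lt_pow_succ_log_self (b := 2) (by norm_num) n
      rwa [hj, show (M + 1 + j).succ = M + j + 2 by simp only [Nat.succ_eq_add_one]; ring] at this
    refine ⟨M + j, by omega, mem_gmG _ _ _ x k hk (fun i => ⟨(hb i).1, ?_⟩) fun i => ?_⟩
    · have := (hb i).2; omega
    · exact (hmono l1).trans (hc i)
  have h1 : gmNu (Fset r ψ) = 0 := measure_mono_null hsub h0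
  unfold gmNu at h1
  rw [withDensity_apply_eq_zero' gmH_meas.aemeasurable] at h1
  have hF : Fset r ψ ⊆ Ico 0 1 := fun x hx => hx.1
  have e : {x | gmH x ≠ 0} ∩ Fset r ψ = Fset r ψ := by
    apply inter_eq_self_of_subset_right
    intro x hx
    have := (hF hx).1
    simp only [mem_ofPred_eq, gmH, ne_eq, ENNReal.ofReal_eq_zero, not_le]
    positivity
  rw [e, Measure.restrict_eq_self _ hF] at h1
  exact h1
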